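/- arXiv:1508.06062 — 5 statements merged into one kernel-verified Lean document; each statement's English description precedes it below -/
import Mathlib

section
/- Let d be a distance on the Heisenberg group ℍ such that d ≤ d_b and H⁴_d(B_{d_b}(0,1)) > 0, where H⁴_d is the Hausdorff 4-measure of (ℍ,d). Assume that every left translation p ↦ q·p (q ∈ ℍ) is biLipschitz with respect to d. Then d and d_b are biLipschitz equivalent on compact sets: for every compact C ⊆ ℍ there is L ≥ 1 with L⁻¹·d_b(p,q) ≤ d(p,q) ≤ L·d_b(p,q) for all p, q ∈ C. -/
open scoped ENNReal

namespace Heis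

/-- The underlying set of the Heisenberg group: `ℝ³`. -/
abbrev H : Type := ℝ × ℝ × ℝ

/-- Heisenberg group multiplication. -/
noncomputable def Hmul (p q : H) : H :=
  (p.1 + q.1, p.2.1 + q.2.1, p.2.2 + q.2.2 + (p.1 * q.2.1 - p.2.1 * q.1) / 2)

/-- Heisenberg group inverse. -/
def Hinv (p : H) : H := (-p.1, -p.2.1, -p.2.2)

/-- The box norm `‖p‖ = max {|x|, |y|, √|z|}`. -/
noncomputable def boxNorm (p : H) : ℝ :=
  max |p.1| (max |p.2.1| (Real.sqrt |p.2.2|))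

/-- The box distance `d_b(p,q) = ‖p⁻¹·q‖`. -/
noncomputable def dbox (p q : H) : ℝ := boxNorm (Hmul (Hinv p) q)

/-- The dilations `δ_λ(x,y,z) = (λx, λy, λ²z)`. -/
noncomputable def dil (lam : ℝ) (p : H) : H := (lam * p.1, lam * p.2.1, lam ^ 2 * p.2.2)

/-- `d` is a distance (metric) on `X`. -/
def IsDistance {X : Type*} (d : X → X → ℝ) : Prop :=
  (∀ x y, d x y = d y x) ∧ (∀ x, d x x = 0) ∧
  (∀ x y, d x y = 0 → x = y) ∧ (∀ x y z, d x z ≤ d x y + d y z)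

/-- The open ball of the distance function `d`. -/
def ballOf {X : Type*} (d : X → X → ℝ) (x : X) (r : ℝ) : Set X := {y | d x y < r}

/-- The (extended) diameter of a set with respect to a distance function `d`. -/
noncomputable def ediamOf {X : Type*} (d : X → X → ℝ) (E : Set X) : ℝ≥0∞ :=
  ⨆ (x ∈ E) (y ∈ E), ENNReal.ofReal (d x y)

/-- The Hausdorff `Q`-measure of `A` with respect to the distance function `d`:
`H^Q_d(A) = lim_{ε→0} inf { Σᵢ (diam Eᵢ)^Q : A ⊆ ⋃ᵢ Eᵢ, diam Eᵢ ≤ ε }`. -/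
noncomputable def hausdorffOf {X : Type*} (d : X → X → ℝ) (Q : ℝ) (A : Set X) : ℝ≥0∞ :=
  ⨆ (ε : ℝ≥0∞) (_ : 0 < ε),
    ⨅ (E : ℕ → Set X) (_ : A ⊆ ⋃ n, E n) (_ : ∀ n, ediamOf d (E n) ≤ ε),
      ∑' n, ediamOf d (E n) ^ Q

/-- `(X, d)` is Ahlfors `Q`-regular: there is `C ≥ 1` with
`C⁻¹ r^Q ≤ H^Q_d(B_d(x,r)) ≤ C r^Q` for all `x` and `0 < r < diam X`. -/
def AhlforsRegularOf {X : Type*} (d : X → X → ℝ) (Q : ℝ) : Prop :=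
  ∃ C : ℝ, 1 ≤ C ∧ ∀ (x : X) (r : ℝ), 0 < r → ENNReal.ofReal r < ediamOf d Set.univ →
    ENNReal.ofReal (C⁻¹ * r ^ Q) ≤ hausdorffOf d Q (ballOf d x r) ∧
    hausdorffOf d Q (ballOf d x r) ≤ ENNReal.ofReal (C * r ^ Q)

/-- The distances `d` and `ρ` are biLipschitz equivalent on the set `A`. -/
def BiLipOn {X : Type*} (d ρ : X → X → ℝ) (A : Set X) : Prop :=
  ∃ L : ℝ, 1 ≤ L ∧ ∀ x ∈ A, ∀ y ∈ A, L⁻¹ * ρ x y ≤ d x y ∧ d x y ≤ L * ρ x y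


theorem boxNorm_le_iff {p : H} {s : ℝ} (hs : 0 ≤ s) :
    boxNorm p ≤ s ↔ |p.1| ≤ s ∧ |p.2.1| ≤ s ∧ |p.2.2| ≤ s ^ 2 := by
  simp only [boxNorm, max_le_iff, Real.sqrt_le_left hs]

theorem boxNorm_lt_iff {p : H} {s : ℝ} (hs : 0 < s) :
    boxNorm p < s ↔ |p.1| < s ∧ |p.2.1| < s ∧ |p.2.2| < s ^ 2 := by
  simp only [boxNorm, max_lt_iff, Real.sqrt_lt' hs]

theorem boxNorm_nonneg (p : H) : 0 ≤ boxNorm p :=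
  (abs_nonneg p.1).trans (le_max_left _ _)

theorem continuous_boxNorm : Continuous boxNorm := by
  unfold boxNorm
  fun_prop

theorem boxNorm_zero : boxNorm (0 : H) = 0 := by
  simp [boxNorm]

theorem boxNorm_Hinv (p : H) : boxNorm (Hinv p) = boxNorm p := by
  simp [boxNorm, Hinv]

theorem boxNorm_Hmul_le (p q : H) : boxNorm (Hmul p q) ≤ boxNorm p + boxNorm q := by
  have hp := boxNorm_nonneg p
  have hq := boxNorm_nonneg q
  obtain ⟨p1, p2, p3⟩ := (boxNorm_le_iff hp).1 le_rfl
  obtain ⟨q1, q2, q3⟩ := (boxNorm_le_iff hq).1 le_rfl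
  refine (boxNorm_le_iff (by positivity)).2 ⟨?_, ?_, ?_⟩
  · exact (abs_add_le _ _).trans (add_le_add p1 q1)
  · exact (abs_add_le _ _).trans (add_le_add p2 q2)
  · have h1 : |p.1 * q.2.1| ≤ boxNorm p * boxNorm q := by
      rw [abs_mul]; gcongr
    have h2 : |p.2.1 * q.1| ≤ boxNorm p * boxNorm q := by
      rw [abs_mul]; gcongr
    simp only [Hmul]
    rw [abs_le] at *
    constructor <;> nlinarith [mul_nonneg hp hq]

theorem Hmul_assoc (a b c : H) : Hmul (Hmul a b) c = Hmul a (Hmul b c) := by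
  ext <;> simp only [Hmul] <;> ring

theorem Hmul_zero (a : H) : Hmul a 0 = a := by
  ext <;> simp [Hmul]

theorem zero_Hmul (a : H) : Hmul 0 a = a := by
  ext <;> simp [Hmul]

theorem Hmul_Hinv (a : H) : Hmul a (Hinv a) = 0 := by
  ext <;> simp [Hmul, Hinv]
  ring

theorem Hinv_Hmul (a : H) : Hmul (Hinv a) a = 0 := by
  ext <;> simp [Hmul, Hinv]
  ring

theorem Hinv_Hmul_cancel_left (a b : H) : Hmul (Hinv a) (Hmul a b) = b := by
  rw [← Hmul_assoc, Hinv_Hmul, zero_Hmul]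

theorem Hmul_Hinv_cancel_left (a b : H) : Hmul a (Hmul (Hinv a) b) = b := by
  rw [← Hmul_assoc, Hmul_Hinv, zero_Hmul]

theorem continuous_Hmul : Continuous fun x : H × H => Hmul x.1 x.2 := by
  unfold Hmul
  fun_prop

theorem continuous_Hinv : Continuous Hinv := by
  unfold Hinv
  fun_prop

theorem continuous_dbox : Continuous fun x : H × H => dbox x.1 x.2 :=
  continuous_boxNorm.comp
    (continuous_Hmul.comp ((continuous_Hinv.comp continuous_fst).prodMk continuous_snd))

theorem dbox_self (p : H) : dbox p p = 0 := by
  rw [dbox, Hinv_Hmul, boxNorm_zero]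

theorem dbox_zero_left (p : H) : dbox 0 p = boxNorm p := by
  rw [dbox, show Hinv 0 = 0 by simp [Hinv], zero_Hmul]

theorem dbox_Hmul_right (p q : H) : dbox p (Hmul p q) = boxNorm q := by
  rw [dbox, Hinv_Hmul_cancel_left]

theorem dbox_comm (p q : H) : dbox p q = dbox q p := by
  rw [dbox, dbox, ← boxNorm_Hinv]
  congr 1
  ext <;> simp only [Hmul, Hinv] <;> ring

theorem dbox_Hmul_left (g p q : H) : dbox (Hmul g p) (Hmul g q) = dbox p q := by
  rw [dbox, dbox]
  congr 1
  ext <;> simp only [Hmul, Hinv] <;> ring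

theorem dbox_triangle (p q r : H) : dbox p r ≤ dbox p q + dbox q r := by
  refine le_of_eq_of_le ?_ (boxNorm_Hmul_le _ _)
  rw [dbox, Hmul_assoc, Hmul_Hinv_cancel_left]

/-- The power `p ^ t` along the one-parameter subgroup through `p`. -/
def Hpow (t : ℝ) (p : H) : H := (t * p.1, t * p.2.1, t * p.2.2)

theorem Hpow_zero (p : H) : Hpow 0 p = 0 := by
  simp [Hpow]

theorem Hpow_add (t u : ℝ) (p : H) : Hpow (t + u) p = Hmul (Hpow t p) (Hpow u p) := by
  ext <;> simp only [Hpow, Hmul] <;> ring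

theorem Hpow_one (p : H) : Hpow 1 p = p := by
  simp [Hpow]

theorem boxNorm_Hpow_natCast_le (n : ℕ) (p : H) : boxNorm (Hpow n p) ≤ n * boxNorm p := by
  induction n with
  | zero => simp [Hpow_zero, boxNorm_zero]
  | succ n ih =>
    push_cast
    rw [Hpow_add, Hpow_one]
    linarith [boxNorm_Hmul_le (Hpow n p) p]

theorem boxNorm_le_boxNorm_Hpow {t : ℝ} (ht : 1 ≤ |t|) (p : H) :
    boxNorm p ≤ boxNorm (Hpow t p) := by
  simp only [boxNorm, Hpow, abs_mul]
  gcongr <;> exact le_mul_of_one_le_left (abs_nonneg _) ht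

theorem dbox_Hpow (t u : ℝ) (p : H) : dbox (Hpow t p) (Hpow u p) = boxNorm (Hpow (u - t) p) := by
  rw [dbox]
  congr 1
  ext <;> simp only [Hmul, Hinv, Hpow] <;> ring

open MeasureTheory

theorem measurePreserving_Hmul (g : H) : MeasurePreserving (Hmul g) := by
  have key (a : ℝ) : MeasurePreserving (fun z : ℝ => a + z) := measurePreserving_add_left volume a
  have hsnd (x : ℝ) : MeasurePreserving (fun w : ℝ × ℝ =>
      (g.2.1 + w.1, g.2.2 + w.2 + (g.1 * w.1 - g.2.1 * x) / 2)) := by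
    refine (key g.2.1).skew_product
      (g := fun y z => g.2.2 + z + (g.1 * y - g.2.1 * x) / 2) (by fun_prop) ?_
    refine Filter.Eventually.of_forall fun y => ?_
    convert (key (g.2.2 + (g.1 * y - g.2.1 * x) / 2)).map_eq using 2
    ext z
    ring
  exact (key g.1).skew_product
    (g := fun x (w : ℝ × ℝ) => (g.2.1 + w.1, g.2.2 + w.2 + (g.1 * w.1 - g.2.1 * x) / 2))
    (by fun_prop) (Filter.Eventually.of_forall fun x => (hsnd x).map_eq)

theorem measurableSet_ballOf_dbox (x : H) (s : ℝ) : MeasurableSet (ballOf dbox x s) :=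
  (isOpen_Iio.preimage (continuous_dbox.comp (Continuous.prodMk_right x))).measurableSet

theorem volume_ballOf_dbox (x : H) {s : ℝ} (hs : 0 < s) :
    volume (ballOf dbox x s) = ENNReal.ofReal (8 * s ^ 4) := by
  have h0 : ballOf dbox 0 s =
      Set.Ioo (-s) s ×ˢ Set.Ioo (-s) s ×ˢ Set.Ioo (-s ^ 2) (s ^ 2) := by
    ext p
    simp only [ballOf, Set.mem_ofPred_eq, dbox_zero_left, boxNorm_lt_iff hs, abs_lt,
      Set.mem_prod, Set.mem_Ioo]
  have hx : Hmul x ⁻¹' ballOf dbox x s = ballOf dbox 0 s := by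
    ext p
    simp [ballOf, dbox_Hmul_right, dbox_zero_left]
  rw [← (measurePreserving_Hmul x).measure_preimage
    (measurableSet_ballOf_dbox x s).nullMeasurableSet, hx, h0, Measure.volume_eq_prod,
    Measure.prod_prod, Measure.volume_eq_prod, Measure.prod_prod]
  simp only [Real.volume_Ioo]
  rw [← ENNReal.ofReal_mul (by linarith), ← ENNReal.ofReal_mul (by linarith)]
  congr 1
  ring

theorem card_mul_pow_le_of_separated {F : Finset H} {s : ℝ} (hs : 0 < s) (hs1 : s ≤ 1)
    (hF : ∀ x ∈ F, boxNorm x ≤ 2) (hsep : ∀ x ∈ F, ∀ y ∈ F, x ≠ y → 2 * s ≤ dbox x y) :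
    (F.card : ℝ) * s ^ 4 ≤ 81 := by
  have hsub : (⋃ x ∈ F, ballOf dbox x s) ⊆ ballOf dbox 0 3 := by
    refine Set.iUnion₂_subset fun x hx y (hy : dbox x y < s) => ?_
    have := dbox_triangle 0 x y
    rw [dbox_zero_left x] at this
    have := hF x hx
    simp only [ballOf, Set.mem_ofPred_eq]
    linarith
  have hdisj : (F : Set H).PairwiseDisjoint fun x => ballOf dbox x s := by
    intro x hx y hy hxy
    refine Set.disjoint_left.2 fun w (h1 : dbox x w < s) (h2 : dbox y w < s) => ?_
    have := dbox_triangle x w y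
    have := hsep x hx y hy hxy
    rw [dbox_comm] at h2
    linarith
  have hvol := measure_mono (μ := volume) hsub
  rw [measure_biUnion_finset hdisj fun x _ => measurableSet_ballOf_dbox x s,
    Finset.sum_congr rfl fun x _ => volume_ballOf_dbox x hs, volume_ballOf_dbox 0 three_pos,
    Finset.sum_const, nsmul_eq_mul, ← ENNReal.ofReal_natCast,
    ← ENNReal.ofReal_mul (by positivity), ENNReal.ofReal_le_ofReal_iff (by norm_num)] at hvol
  linarith

section Distance

variable {d : H → H → ℝ}

theorem IsDistance.nonneg (hd : IsDistance d) (p q : H) : 0 ≤ d p q := by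
  obtain ⟨hsymm, hself, -, htri⟩ := hd
  have := htri p q p
  rw [hself, hsymm q p] at this
  linarith

theorem IsDistance.continuous (hd : IsDistance d) (hle : ∀ p q : H, d p q ≤ dbox p q) :
    Continuous fun x : H × H => d x.1 x.2 := by
  obtain ⟨hsymm, -, -, htri⟩ := hd
  refine continuous_iff_continuousAt.2 fun x => ?_
  rw [ContinuousAt, tendsto_iff_dist_tendsto_zero]
  have hlim : Filter.Tendsto (fun y : H × H => dbox x.1 y.1 + dbox x.2 y.2) (nhds x) (nhds 0) := by
    have hc : Continuous fun y : H × H => dbox x.1 y.1 + dbox x.2 y.2 :=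
      (continuous_dbox.comp (continuous_const.prodMk continuous_fst)).add
        (continuous_dbox.comp (continuous_const.prodMk continuous_snd))
    simpa [dbox_self] using hc.tendsto x
  refine squeeze_zero (fun _ => dist_nonneg) (fun y => ?_) hlim
  rw [Real.dist_eq, abs_le]
  have h1 := hle x.1 y.1
  have h2 := hle x.2 y.2
  have h3 := htri y.1 x.1 y.2
  have h4 := htri x.1 x.2 y.2
  have h5 := htri x.1 y.1 x.2
  have h6 := htri y.1 y.2 x.2
  rw [hsymm y.1 x.1] at h3
  rw [hsymm y.2 x.2] at h6
  constructor <;> linarith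

/-- By Baire's theorem, left translations are locally uniformly Lipschitz. -/
theorem exists_uniform_lipschitz_translation (hd : IsDistance d)
    (hle : ∀ p q : H, d p q ≤ dbox p q)
    (htrans : ∀ g : H, ∃ L : ℝ, ∀ p q : H, d (Hmul g p) (Hmul g q) ≤ L * d p q)
    {K : Set H} (hK : IsCompact K) :
    ∃ L : ℝ, 0 ≤ L ∧ ∀ g ∈ K, ∀ p q : H, d (Hmul g p) (Hmul g q) ≤ L * d p q := by
  have hnn := hd.nonneg
  let G : ℕ → Set H := fun n => {g | ∀ p q : H, d (Hmul g p) (Hmul g q) ≤ n * d p q}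
  have hclosed (n : ℕ) : IsClosed (G n) := by
    simp only [G, Set.ofPred_forall]
    refine isClosed_iInter fun p => isClosed_iInter fun q => isClosed_le ?_ continuous_const
    exact (hd.continuous hle).comp
      ((continuous_Hmul.comp (continuous_id.prodMk continuous_const)).prodMk
        (continuous_Hmul.comp (continuous_id.prodMk continuous_const)))
  have hunion : ⋃ n, G n = Set.univ := by
    refine Set.eq_univ_of_forall fun g => ?_
    obtain ⟨L, hL⟩ := htrans g
    obtain ⟨n, hn⟩ := exists_nat_ge L
    exact Set.mem_iUnion.2 ⟨n, fun p q =>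
      (hL p q).trans (mul_le_mul_of_nonneg_right hn (hnn p q))⟩
  obtain ⟨n, g₀, hg₀⟩ := nonempty_interior_of_iUnion_of_closed hclosed hunion
  refine hK.induction_on (p := fun S => ∃ L : ℝ, 0 ≤ L ∧ ∀ g ∈ S, ∀ p q : H,
    d (Hmul g p) (Hmul g q) ≤ L * d p q) ⟨0, le_rfl, by simp⟩ ?_ ?_ ?_
  · rintro S T hST ⟨L, h0, hL⟩
    exact ⟨L, h0, fun g hg => hL g (hST hg)⟩
  · rintro S T ⟨L, h0, hL⟩ ⟨M, h0', hM⟩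
    refine ⟨max L M, le_max_of_le_left h0, ?_⟩
    rintro g (hg | hg) p q
    · exact (hL g hg p q).trans (mul_le_mul_of_nonneg_right (le_max_left _ _) (hnn p q))
    · exact (hM g hg p q).trans (mul_le_mul_of_nonneg_right (le_max_right _ _) (hnn p q))
  · intro h _
    obtain ⟨L, hL⟩ := htrans (Hmul h (Hinv g₀))
    have hcont : Continuous fun g => Hmul (Hmul g₀ (Hinv h)) g :=
      continuous_Hmul.comp (continuous_const.prodMk continuous_id)
    have hmem : (fun g => Hmul (Hmul g₀ (Hinv h)) g) ⁻¹' interior (G n) ∈ nhds h := by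
      refine (isOpen_interior.preimage hcont).mem_nhds ?_
      rwa [Set.mem_preimage, Hmul_assoc, Hinv_Hmul, Hmul_zero]
    refine ⟨_, mem_nhdsWithin_of_mem_nhds hmem, max L 0 * n, by positivity, fun g hg p q => ?_⟩
    have hg' := interior_subset hg p q
    have hgx (x : H) : Hmul g x =
        Hmul (Hmul h (Hinv g₀)) (Hmul (Hmul (Hmul g₀ (Hinv h)) g) x) := by
      rw [Hmul_assoc, Hmul_assoc, Hmul_assoc, Hinv_Hmul_cancel_left, Hmul_Hinv_cancel_left]
    rw [hgx p, hgx q, mul_assoc]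
    refine (hL _ _).trans ?_
    exact mul_le_mul (le_max_left _ _) hg' (hnn _ _) (le_max_right _ _)

theorem ediamOf_closedBall_le (hd : IsDistance d) (x : H) (ρ : ℝ) :
    ediamOf d {y | d x y ≤ ρ} ≤ ENNReal.ofReal (2 * ρ) := by
  refine iSup₂_le fun y hy => iSup₂_le fun z hz => ENNReal.ofReal_le_ofReal ?_
  have := hd.2.2.2 y x z
  rw [hd.1 y x] at this
  simp only [Set.mem_ofPred_eq] at hy hz
  linarith

theorem iInf_cover_le (hd : IsDistance d) {A : Set H} {Q : Finset H} {ρ : ℝ} (hρ : 0 ≤ ρ)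
    {ε : ℝ≥0∞} (hε : ENNReal.ofReal (2 * ρ) ≤ ε) (hcov : ∀ y ∈ A, ∃ x ∈ Q, d x y ≤ ρ) :
    ⨅ (E : ℕ → Set H) (_ : A ⊆ ⋃ n, E n) (_ : ∀ n, ediamOf d (E n) ≤ ε),
      ∑' n, ediamOf d (E n) ^ (4 : ℝ) ≤ ENNReal.ofReal (Q.card * (2 * ρ) ^ 4) := by
  let e := Q.equivFin
  let E : ℕ → Set H := fun n => if h : n < Q.card then {y | d (e.symm ⟨n, h⟩ : H) y ≤ ρ} else ∅
  have hE_pos {n : ℕ} (h : n < Q.card) : E n = {y | d (e.symm ⟨n, h⟩ : H) y ≤ ρ} := dif_pos h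
  have hE_neg {n : ℕ} (h : ¬ n < Q.card) : ediamOf d (E n) = 0 := by
    simp [E, h, ediamOf]
  have hdiam {n : ℕ} (h : n < Q.card) : ediamOf d (E n) ≤ ENNReal.ofReal (2 * ρ) := by
    rw [hE_pos h]
    exact ediamOf_closedBall_le hd _ _
  refine iInf_le_of_le E (iInf_le_of_le ?_ (iInf_le_of_le ?_ ?_))
  · intro y hy
    obtain ⟨x, hx, hxy⟩ := hcov y hy
    refine Set.mem_iUnion.2 ⟨e ⟨x, hx⟩, ?_⟩
    rw [hE_pos (e ⟨x, hx⟩).isLt]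
    simpa using hxy
  · intro n
    by_cases h : n < Q.card
    · exact (hdiam h).trans hε
    · simp [hE_neg h]
  · rw [tsum_eq_sum (s := Finset.range Q.card) fun n hn => by
      rw [hE_neg (by simpa using hn)]; simp]
    calc ∑ n ∈ Finset.range Q.card, ediamOf d (E n) ^ (4 : ℝ)
        ≤ ∑ n ∈ Finset.range Q.card, ENNReal.ofReal (2 * ρ) ^ (4 : ℝ) := by
          gcongr with n hn
          exact hdiam (Finset.mem_range.1 hn)
      _ = ENNReal.ofReal (Q.card * (2 * ρ) ^ 4) := by
          rw [Finset.sum_const, Finset.card_range, nsmul_eq_mul,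
            ENNReal.ofReal_mul (Nat.cast_nonneg Q.card), ENNReal.ofReal_natCast,
            ENNReal.ofReal_pow (by positivity)]
          norm_cast

/-- A bound on the cardinality of separated sets yields a maximal one, which is a net. -/
theorem exists_separated_net (hd : IsDistance d) {A : Set H} {ρ : ℝ} (hρ : 0 ≤ ρ) {M : ℕ}
    (hM : ∀ Q : Finset H, (∀ x ∈ Q, x ∈ A) → (∀ x ∈ Q, ∀ y ∈ Q, x ≠ y → ρ < d x y) → Q.card ≤ M) :
    ∃ Q : Finset H, (∀ x ∈ Q, x ∈ A) ∧ (∀ x ∈ Q, ∀ y ∈ Q, x ≠ y → ρ < d x y) ∧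
      ∀ y ∈ A, ∃ x ∈ Q, d x y ≤ ρ := by
  classical
  let S : Set ℕ := {n | ∃ Q : Finset H, (∀ x ∈ Q, x ∈ A) ∧
    (∀ x ∈ Q, ∀ y ∈ Q, x ≠ y → ρ < d x y) ∧ Q.card = n}
  have hbdd : BddAbove S := ⟨M, by rintro _ ⟨Q, h1, h2, rfl⟩; exact hM Q h1 h2⟩
  obtain ⟨Q, hQA, hQ, hcard⟩ := Nat.sSup_mem (s := S) ⟨0, ∅, by simp⟩ hbdd
  refine ⟨Q, hQA, hQ, fun y hy => ?_⟩
  by_contra! hfar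
  have hyQ : y ∉ Q := fun h => absurd (hfar y h) (by rw [hd.2.1]; exact not_lt.2 hρ)
  have hmem : (insert y Q).card ∈ S := by
    refine ⟨insert y Q, Finset.forall_mem_insert _ _ _ |>.2 ⟨hy, hQA⟩, fun a ha b hb hab => ?_, rfl⟩
    rcases Finset.mem_insert.1 ha with rfl | ha' <;> rcases Finset.mem_insert.1 hb with rfl | hb'
    · exact absurd rfl hab
    · rw [hd.1]
      exact hfar b hb'
    · exact hfar a ha'
    · exact hQ a ha' b hb' hab
  have := le_csSup hbdd hmem
  rw [Finset.card_insert_of_notMem hyQ, ← hcard] at this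
  omega

theorem dist_Hmul_Hpow_le (hd : IsDistance d) {L r : ℝ} {p q : H} {N k : ℕ}
    (hL : ∀ g : H, boxNorm g ≤ r → ∀ p q : H, d (Hmul g p) (Hmul g q) ≤ L * d p q)
    (hq : boxNorm q + N * boxNorm p ≤ r) (hk : k ≤ N) :
    d q (Hmul q (Hpow k p)) ≤ k * (L * d 0 p) := by
  induction k with
  | zero => simp [Hpow_zero, Hmul_zero, hd.2.1]
  | succ k ih =>
    have hnorm : boxNorm (Hmul q (Hpow k p)) ≤ r := by
      have h1 := boxNorm_Hmul_le q (Hpow k p)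
      have h2 := boxNorm_Hpow_natCast_le k p
      have h3 : (k : ℝ) * boxNorm p ≤ N * boxNorm p :=
        mul_le_mul_of_nonneg_right (by exact_mod_cast (Nat.le_of_succ_le hk)) (boxNorm_nonneg p)
      linarith
    have h1 := hL _ hnorm 0 p
    have h2 := hd.2.2.2 q (Hmul q (Hpow k p)) (Hmul q (Hpow (k + 1 : ℕ) p))
    have h3 := ih (Nat.le_of_succ_le hk)
    push_cast at *
    rw [Hmul_zero] at h1
    rw [Hpow_add, Hpow_one, ← Hmul_assoc] at h2 ⊢
    linarith

/-- If `p` is much shorter for `d` than for `dbox`, then `d`-separated sets are small. -/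
theorem card_mul_le_of_short (hd : IsDistance d) (hle : ∀ p q : H, d p q ≤ dbox p q)
    {L : ℝ} (hL0 : 0 ≤ L)
    (hL : ∀ g : H, boxNorm g ≤ 2 → ∀ p q : H, d (Hmul g p) (Hmul g q) ≤ L * d p q)
    {N : ℕ} (hN : 0 < N) {p : H} (hp0 : 0 < d 0 p) (hpN : N * boxNorm p ≤ 1)
    (hshort : 2 * (N * d 0 p) ≤ boxNorm p) {Q : Finset H} (hQ : ∀ x ∈ Q, x ∈ ballOf dbox 0 1)
    (hsep : ∀ x ∈ Q, ∀ y ∈ Q, x ≠ y → 2 * (L + 1) * (N * d 0 p) < d x y) :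
    (Q.card : ℝ) * N * (N * d 0 p) ^ 4 ≤ 81 := by
  classical
  have hN1 : (1 : ℝ) ≤ N := by exact_mod_cast hN
  have hs : 0 < N * d 0 p := by positivity
  have hs1 : N * d 0 p ≤ 1 := by nlinarith [boxNorm_nonneg p]
  have hQ' (x) (hx : x ∈ Q) : boxNorm x < 1 := by
    simpa [ballOf, dbox_zero_left] using hQ x hx
  have hmove (x) (hx : x ∈ Q) (k : ℕ) (hk : k < N) :
      d x (Hmul x (Hpow k p)) ≤ L * (N * d 0 p) := by
    refine (dist_Hmul_Hpow_le hd hL (by linarith [hQ' x hx]) hk.le).trans ?_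
    have : (k : ℝ) * (L * d 0 p) ≤ N * (L * d 0 p) := by gcongr
    linarith
  have hfar (a b : H × ℕ) (ha : a ∈ Q ×ˢ Finset.range N) (hb : b ∈ Q ×ˢ Finset.range N)
      (hab : a ≠ b) :
      2 * (N * d 0 p) ≤ dbox (Hmul a.1 (Hpow a.2 p)) (Hmul b.1 (Hpow b.2 p)) := by
    obtain ⟨x, k⟩ := a
    obtain ⟨y, j⟩ := b
    simp only [Finset.mem_product, Finset.mem_range] at ha hb ⊢
    by_cases hxy : x = y
    · subst hxy
      have hkj : k ≠ j := fun h => hab (by rw [h])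
      rw [dbox_Hmul_left, dbox_Hpow]
      refine hshort.trans (boxNorm_le_boxNorm_Hpow ?_ p)
      exact_mod_cast Int.one_le_abs (sub_ne_zero.2 (Nat.cast_injective (R := ℤ) |>.ne hkj.symm))
    · have h1 := hsep x ha.1 y hb.1 hxy
      have h2 := hmove x ha.1 k ha.2
      have h3 := hmove y hb.1 j hb.2
      rw [hd.1] at h3
      have h4 := hle (Hmul x (Hpow k p)) (Hmul y (Hpow j p))
      have h5 := hd.2.2.2 x (Hmul x (Hpow k p)) y
      have h6 := hd.2.2.2 (Hmul x (Hpow k p)) (Hmul y (Hpow j p)) y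
      linarith
  let f : H × ℕ → H := fun a => Hmul a.1 (Hpow a.2 p)
  have hinj : Set.InjOn f ↑(Q ×ˢ Finset.range N) := by
    intro a ha b hb hab
    by_contra hne
    have := hfar a b ha hb hne
    simp only [f] at hab
    rw [hab, dbox_self] at this
    linarith
  have hcount := card_mul_pow_le_of_separated (F := (Q ×ˢ Finset.range N).image f) hs hs1 ?_ ?_
  · rw [Finset.card_image_of_injOn hinj, Finset.card_product, Finset.card_range] at hcount
    exact_mod_cast hcount
  · intro z hz
    obtain ⟨⟨x, k⟩, ha, rfl⟩ := Finset.mem_image.1 hz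
    simp only [Finset.mem_product, Finset.mem_range] at ha
    have h1 := boxNorm_Hmul_le x (Hpow k p)
    have h2 := boxNorm_Hpow_natCast_le k p
    have h3 : (k : ℝ) * boxNorm p ≤ N * boxNorm p :=
      mul_le_mul_of_nonneg_right (by exact_mod_cast ha.2.le) (boxNorm_nonneg p)
    have h4 := hQ' x ha.1
    simp only [f]
    linarith
  · intro z hz w hw hzw
    obtain ⟨a, ha, rfl⟩ := Finset.mem_image.1 hz
    obtain ⟨b, hb, rfl⟩ := Finset.mem_image.1 hw
    exact hfar a b ha hb fun h => hzw (by rw [h])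

/-- If `d` is not bounded below by a multiple of `dbox` near the identity, then the unit box ball
is a null set for the Hausdorff `4`-measure of `d`. -/
theorem hausdorffOf_ballOf_eq_zero (hd : IsDistance d) (hle : ∀ p q : H, d p q ≤ dbox p q)
    {L : ℝ} (hL0 : 0 ≤ L)
    (hL : ∀ g : H, boxNorm g ≤ 2 → ∀ p q : H, d (Hmul g p) (Hmul g q) ≤ L * d p q)
    (hshort : ∀ c : ℝ, 0 < c → ∀ r : ℝ, 0 < r → ∃ p : H, boxNorm p ≤ r ∧ d 0 p < c * boxNorm p) :
    hausdorffOf d 4 (ballOf dbox 0 1) = 0 := by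
  refine le_antisymm (iSup₂_le fun ε hε => ?_) zero_le
  have hlim : Filter.Tendsto (fun N : ℕ => ENNReal.ofReal (81 * (4 * (L + 1)) ^ 4 / N))
      Filter.atTop (nhds 0) := by
    simpa using ENNReal.tendsto_ofReal (tendsto_const_div_atTop_nhds_zero_nat _)
  refine ge_of_tendsto hlim (Filter.eventually_atTop.2 ⟨1, fun N hN => ?_⟩)
  have hNpos : (0 : ℝ) < N := by exact_mod_cast hN
  obtain ⟨η, hη, hηε⟩ : ∃ η : ℝ, 0 < η ∧ ENNReal.ofReal η ≤ ε := by
    refine ⟨(min ε 1).toReal, ENNReal.toReal_pos (by simp [hε.ne']) (by simp), ?_⟩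
    rw [ENNReal.ofReal_toReal (by simp)]
    exact min_le_left _ _
  obtain ⟨p, hpr, hp⟩ := hshort (1 / (2 * N)) (by positivity)
    (min (1 / N) (η / (2 * (L + 1)))) (by positivity)
  have hpN := hpr.trans (min_le_left _ _)
  have hpη := hpr.trans (min_le_right _ _)
  rw [le_div_iff₀ (by positivity)] at hpN hpη
  rw [div_mul_eq_mul_div, one_mul, lt_div_iff₀ (by positivity)] at hp
  have hp0 : 0 < d 0 p := by
    refine (hd.nonneg 0 p).lt_of_ne fun h => ?_
    have := hd.2.2.1 0 p h.symm
    subst this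
    rw [boxNorm_zero, hd.2.1] at hp
    simp at hp
  have hcard (Q : Finset H) (h1 : ∀ x ∈ Q, x ∈ ballOf dbox 0 1)
      (h2 : ∀ x ∈ Q, ∀ y ∈ Q, x ≠ y → 2 * (L + 1) * (N * d 0 p) < d x y) :
      (Q.card : ℝ) * N * (N * d 0 p) ^ 4 ≤ 81 :=
    card_mul_le_of_short hd hle hL0 hL hN hp0 (by linarith) (by linarith) h1 h2
  have hρ : 0 ≤ 2 * (L + 1) * (N * d 0 p) := by positivity
  obtain ⟨Q, hQA, hQ, hcov⟩ := exists_separated_net hd (A := ballOf dbox 0 1) hρ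
    (M := ⌊81 / (N * (N * d 0 p) ^ 4)⌋₊) fun Q h1 h2 => by
      refine Nat.le_floor ?_
      rw [le_div_iff₀ (by positivity), ← mul_assoc]
      exact hcard Q h1 h2
  refine (iInf_cover_le hd hρ ((ENNReal.ofReal_le_ofReal ?_).trans hηε) hcov).trans
    (ENNReal.ofReal_le_ofReal ?_)
  · nlinarith
  · rw [le_div_iff₀ hNpos]
    calc (Q.card : ℝ) * (2 * (2 * (L + 1) * (N * d 0 p))) ^ 4 * N
        = (Q.card * N * (N * d 0 p) ^ 4) * (4 * (L + 1)) ^ 4 := by ring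
      _ ≤ 81 * (4 * (L + 1)) ^ 4 := by
        gcongr
        exact hcard Q hQA hQ

theorem isCompact_boxNorm_le (r : ℝ) : IsCompact {p : H | boxNorm p ≤ r} := by
  rcases lt_or_ge r 0 with hr | hr
  · convert isCompact_empty
    exact Set.eq_empty_of_forall_notMem fun p hp => (hp.trans_lt hr).not_ge (boxNorm_nonneg p)
  · have : {p : H | boxNorm p ≤ r} =
        Set.Icc (-r) r ×ˢ Set.Icc (-r) r ×ˢ Set.Icc (-r ^ 2) (r ^ 2) := by
      ext p
      simp only [Set.mem_ofPred_eq, boxNorm_le_iff hr, abs_le, Set.mem_prod, Set.mem_Icc]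
    rw [this]
    exact isCompact_Icc.prod (isCompact_Icc.prod isCompact_Icc)

/-- A lower bound near the identity extends to compact sets. -/
theorem exists_lower_bound_of_local (hd : IsDistance d) (hle : ∀ p q : H, d p q ≤ dbox p q)
    {c r : ℝ} (hc : 0 < c) (hr : 0 < r)
    (hloc : ∀ p : H, boxNorm p ≤ r → c * boxNorm p ≤ d 0 p) {D : Set H} (hD : IsCompact D) :
    ∃ c' : ℝ, 0 < c' ∧ ∀ p ∈ D, c' * boxNorm p ≤ d 0 p := by
  have hD' : IsCompact (D ∩ {p | r ≤ boxNorm p}) :=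
    hD.inter_right (isClosed_le continuous_const continuous_boxNorm)
  have hne (p) (hp : p ∈ D ∩ {p | r ≤ boxNorm p}) : boxNorm p ≠ 0 :=
    (hr.trans_le hp.2).ne'
  rcases (D ∩ {p | r ≤ boxNorm p}).eq_empty_or_nonempty with hempty | hnonempty
  · refine ⟨c, hc, fun p hp => hloc p (not_lt.1 fun h => ?_)⟩
    exact Set.notMem_empty p (hempty ▸ ⟨hp, h.le⟩)
  · have hcont : Continuous fun p => d 0 p :=
      (hd.continuous hle).comp (Continuous.prodMk_right 0)
    obtain ⟨w, hw, hmin⟩ := hD'.exists_isMinOn hnonempty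
      (hcont.continuousOn.div continuous_boxNorm.continuousOn hne)
    have hw0 : 0 < d 0 w := by
      refine (hd.nonneg 0 w).lt_of_ne fun h => hne w hw ?_
      rw [← hd.2.2.1 0 w h.symm, boxNorm_zero]
    have hwn : 0 < boxNorm w := hr.trans_le hw.2
    refine ⟨min c (d 0 w / boxNorm w), by positivity, fun p hp => ?_⟩
    rcases le_total (boxNorm p) r with h | h
    · exact (mul_le_mul_of_nonneg_right (min_le_left _ _) (boxNorm_nonneg p)).trans (hloc p h)
    · rw [← le_div_iff₀ (hr.trans_le h)]
      exact (min_le_right _ _).trans (hmin ⟨hp, h⟩)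

end Distance

/-- Theorem 1.4. -/
theorem statement3 (d : H → H → ℝ) (hd : IsDistance d)
    (hle : ∀ p q : H, d p q ≤ dbox p q)
    (hpos : 0 < hausdorffOf d 4 (ballOf dbox ((0:ℝ), (0:ℝ), (0:ℝ)) 1))
    (htrans : ∀ g : H, ∃ L : ℝ, 1 ≤ L ∧ ∀ p q : H,
      L⁻¹ * d p q ≤ d (Hmul g p) (Hmul g q) ∧ d (Hmul g p) (Hmul g q) ≤ L * d p q) :
    ∀ C : Set H, IsCompact C → ∃ L : ℝ, 1 ≤ L ∧
      ∀ p ∈ C, ∀ q ∈ C, L⁻¹ * dbox p q ≤ d p q ∧ d p q ≤ L * dbox p q := by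
  intro C hC
  have hlip (g : H) : ∃ L : ℝ, ∀ p q : H, d (Hmul g p) (Hmul g q) ≤ L * d p q :=
    let ⟨L, _, hL⟩ := htrans g
    ⟨L, fun p q => (hL p q).2⟩
  obtain ⟨L₀, hL₀, hL₀'⟩ :=
    exists_uniform_lipschitz_translation hd hle hlip (isCompact_boxNorm_le 2)
  obtain ⟨c, hc, r, hr, hloc⟩ : ∃ c : ℝ, 0 < c ∧ ∃ r : ℝ, 0 < r ∧
      ∀ p : H, boxNorm p ≤ r → c * boxNorm p ≤ d 0 p := by
    by_contra! h
    exact hpos.ne' (hausdorffOf_ballOf_eq_zero hd hle hL₀ hL₀' h)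
  obtain ⟨c', hc', hlow⟩ := exists_lower_bound_of_local hd hle hc hr hloc
    ((hC.prod hC).image (continuous_Hmul.comp
      ((continuous_Hinv.comp continuous_fst).prodMk continuous_snd)))
  obtain ⟨L₁, hL₁, hL₁'⟩ :=
    exists_uniform_lipschitz_translation hd hle hlip (hC.image continuous_Hinv)
  have hM : 1 ≤ max 1 (L₁ / c') := le_max_left _ _
  refine ⟨max 1 (L₁ / c'), hM, fun p hp q hq => ⟨?_, ?_⟩⟩
  · have h1 : c' * dbox p q ≤ d 0 (Hmul (Hinv p) q) := hlow _ ⟨(p, q), ⟨hp, hq⟩, rfl⟩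
    have h2 := hL₁' (Hinv p) ⟨p, hp, rfl⟩ p q
    rw [Hinv_Hmul] at h2
    rw [inv_mul_le_iff₀ (by positivity)]
    calc dbox p q ≤ L₁ / c' * d p q := by
          rw [div_mul_eq_mul_div, le_div_iff₀ hc']
          linarith
      _ ≤ max 1 (L₁ / c') * d p q :=
          mul_le_mul_of_nonneg_right (le_max_right _ _) (hd.nonneg p q)
  · exact (hle p q).trans (le_mul_of_one_le_left (boxNorm_nonneg _) hM)

end Heis
end

section
/- Let δ ∈ (0,1), let a, b be real numbers with 0 < a and 0 < b, and let c be a real number with 0 ≤ c ≤ (1/δ − 1)·min(a, b). Then (a + b + c)^δ ≤ a^δ + b^δ. -/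
open scoped ENNReal

namespace Heis

/-- The concavity inequality with the smaller number scaled by `1 / δ`. -/
theorem add_div_rpow_le_rpow_add_rpow {δ a b : ℝ} (hδ0 : 0 < δ) (hδ1 : δ ≤ 1)
    (ha : 0 < a) (hab : a ≤ b) : (b + a / δ) ^ δ ≤ a ^ δ + b ^ δ := by
  have hb : 0 < b := ha.trans_le hab
  have hs : 0 ≤ a / b / δ := by positivity
  calc (b + a / δ) ^ δ = (b * (1 + a / b / δ)) ^ δ := by
        congr 1
        field_simp
    _ = b ^ δ * (1 + a / b / δ) ^ δ := Real.mul_rpow hb.le (by positivity)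
    _ ≤ b ^ δ * (1 + δ * (a / b / δ)) := by
        gcongr
        exact rpow_one_add_le_one_add_mul_self (by linarith) hδ0.le hδ1
    _ = b ^ δ * (1 + a / b) := by rw [mul_div_cancel₀ _ hδ0.ne']
    _ ≤ b ^ δ * (1 + (a / b) ^ δ) := by
        gcongr
        exact Real.self_le_rpow_of_le_one (by positivity) ((div_le_one hb).2 hab) hδ1
    _ = a ^ δ + b ^ δ := by
        rw [mul_add, ← Real.mul_rpow hb.le (by positivity), mul_div_cancel₀ _ hb.ne']
        ring

/-- The concavity inequality for snowflake exponents. -/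
theorem statement10 (δ a b c : ℝ) (hδ0 : 0 < δ) (hδ1 : δ < 1)
    (ha : 0 < a) (hb : 0 < b) (hc0 : 0 ≤ c) (hc : c ≤ (1 / δ - 1) * min a b) :
    (a + b + c) ^ δ ≤ a ^ δ + b ^ δ := by
  wlog hab : a ≤ b generalizing a b
  · rw [add_comm a b, add_comm (a ^ δ)]
    exact this b a hb ha (min_comm a b ▸ hc) (le_of_not_ge hab)
  rw [min_eq_left hab] at hc
  refine (Real.rpow_le_rpow (by positivity) ?_ hδ0.le).trans
    (add_div_rpow_le_rpow_add_rpow hδ0 hδ1.le ha hab)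
  linarith [show (1 / δ - 1) * a = a / δ - a by ring]

end Heis
end

section
/- Let p_h denote the h-th prime number and define a : ℕ → {0,1} by a(i) = 1 if there exist an odd k ∈ ℕ and ℓ ≥ 1 such that i = (k·ℓ·∏_{h<ℓ} p_h + 1)·p_ℓ, and a(i) = 0 otherwise. Then for every ℓ ≥ 1 there exists m ≥ 1 such that for every i ≥ 1 there exists j ∈ {i, i+1, …, i+mℓ} with a(j) ≠ a(j + mℓ). -/
open scoped ENNReal

namespace Heis

/-- The `h`-th prime number (`nthP 1 = 2`, `nthP 2 = 3`, …). -/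
noncomputable def nthP (h : ℕ) : ℕ := Nat.nth Nat.Prime (h - 1)

open Classical in
/-- The 0/1 sequence determining on which scales shortcuts are taken:
`aFun i = 1` iff `i = (k·ℓ·∏_{h<ℓ} p_h + 1)·p_ℓ` for some odd `k` and some `ℓ ≥ 1`. -/
noncomputable def aFun (i : ℕ) : ℕ :=
  if ∃ k l : ℕ, Odd k ∧ 1 ≤ l ∧
      i = (k * l * (∏ h ∈ Finset.Ico 1 l, nthP h) + 1) * nthP l
  then 1 else 0

theorem prime_nthP (h : ℕ) : (nthP h).Prime :=
  Nat.prime_nth_prime _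

theorem nthP_lt_nthP {a b : ℕ} (ha : 1 ≤ a) (hab : a < b) : nthP a < nthP b :=
  Nat.nth_strictMono Nat.infinite_setOfPred_prime (by omega)

/-- The least prime factor of `(c * ∏_{h<a} p_h + 1) * p_a` is `p_a`; here in the form of a
strict inequality between indices being impossible. -/
theorem not_lt_of_mul_nthP_eq {a b c d : ℕ} (ha : 1 ≤ a)
    (h : (c * (∏ h ∈ Finset.Ico 1 a, nthP h) + 1) * nthP a =
      (d * (∏ h ∈ Finset.Ico 1 b, nthP h) + 1) * nthP b) : ¬ a < b := by
  intro hab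
  have hdvd : nthP a ∣ (d * (∏ h ∈ Finset.Ico 1 b, nthP h) + 1) * nthP b :=
    h ▸ dvd_mul_left _ _
  have hprod : nthP a ∣ d * ∏ h ∈ Finset.Ico 1 b, nthP h :=
    (Finset.dvd_prod_of_mem nthP (Finset.mem_Ico.2 ⟨ha, hab⟩)).mul_left d
  rcases (prime_nthP a).dvd_mul.1 hdvd with h1 | h1
  · exact (prime_nthP a).one_lt.ne' (Nat.dvd_one.1 ((Nat.dvd_add_right hprod).1 h1))
  · exact (nthP_lt_nthP ha hab).ne ((Nat.prime_dvd_prime_iff_eq (prime_nthP a) (prime_nthP b)).1 h1)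

theorem aFun_eq_ite_odd {l : ℕ} (hl : 1 ≤ l) (k : ℕ) :
    aFun ((k * l * (∏ h ∈ Finset.Ico 1 l, nthP h) + 1) * nthP l) = if Odd k then 1 else 0 := by
  classical
  unfold aFun
  refine if_congr ⟨?_, fun hk => ⟨k, l, hk, hl, rfl⟩⟩ rfl rfl
  rintro ⟨k', l', hk', hl', h⟩
  obtain rfl : l = l' := le_antisymm (not_lt.1 (not_lt_of_mul_nthP_eq hl' h.symm))
    (not_lt.1 (not_lt_of_mul_nthP_eq hl h))
  have hP : 0 < ∏ h ∈ Finset.Ico 1 l, nthP h := Finset.prod_pos fun h _ => (prime_nthP h).pos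
  have h1 := Nat.succ_injective (Nat.eq_of_mul_eq_mul_right (prime_nthP l).pos h)
  have h2 := Nat.eq_of_mul_eq_mul_right hl (Nat.eq_of_mul_eq_mul_right hP h1)
  exact h2 ▸ hk'

/-- Lemma 6.1. -/
theorem statement12 :
    ∀ l : ℕ, 1 ≤ l → ∃ m : ℕ, 1 ≤ m ∧
      ∀ i : ℕ, 1 ≤ i → ∃ j : ℕ, i ≤ j ∧ j ≤ i + m * l ∧
        aFun j ≠ aFun (j + m * l) := by
  intro l hl
  set P := ∏ h ∈ Finset.Ico 1 l, nthP h with hPdef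
  have hP : 0 < P := Finset.prod_pos fun h _ => (prime_nthP h).pos
  have hp : 0 < nthP l := (prime_nthP l).pos
  refine ⟨P * nthP l, Nat.mul_pos hP hp, fun i hi => ?_⟩
  set S := P * nthP l * l with hS
  have hSpos : 0 < S := by positivity
  have hpS : nthP l ≤ S := Nat.le_of_dvd hSpos ⟨P * l, by rw [hS]; ring⟩
  have key : ∀ k : ℕ, aFun (nthP l + k * S) = if Odd k then 1 else 0 := fun k => by
    rw [← aFun_eq_ite_odd hl k]
    congr 1
    rw [hS, ← hPdef]
    ring
  set n := i - nthP l + (S - 1) with hn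
  have hdiv := Nat.div_add_mod' n S
  have hmod := Nat.mod_lt n hSpos
  have hsmall : i ≤ nthP l → n / S * S = 0 := fun h => by
    rw [Nat.div_eq_of_lt (by omega), zero_mul]
  refine ⟨nthP l + n / S * S, by omega, by omega, ?_⟩
  rw [show nthP l + n / S * S + S = nthP l + (n / S + 1) * S by ring, key, key]
  by_cases hodd : Odd (n / S) <;> simp [hodd, Nat.odd_add_one]

end Heis
end

section
/- Consider the 16 similitudes of the Heisenberg group S_{i,j,k}(p) = (i/2, j/2, k/4)·δ_{1/2}(p), for i, j ∈ {0,1} and k ∈ {0,1,2,3}, relabeled as S₁, …, S₁₆. For n ≥ 3, the set A = { S_𝐢(1/2, 1/2, 0) : 𝐢 ∈ {1,…,16}^{n−3} }, where S_𝐢 = S_{i₁} ∘ ⋯ ∘ S_{i_{n−3}} (and S_∅ = id), is 2^{−n+2}-separated with respect to the box distance: any two distinct points x, y ∈ A satisfy d_b(x, y) ≥ 2^{−n+2}. -/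
open scoped ENNReal

namespace Heis

/-- The 16 similitudes `S_{i,j,k}(p) = (i/2, j/2, k/4) · δ_{1/2}(p)` of the Heisenberg
group, indexed by `(i, j, k) ∈ {0,1} × {0,1} × {0,1,2,3}`. -/
noncomputable def Sim (a : Fin 2 × Fin 2 × Fin 4) (p : H) : H :=
  Hmul (((a.1 : ℕ) : ℝ) / 2, ((a.2.1 : ℕ) : ℝ) / 2, ((a.2.2 : ℕ) : ℝ) / 4) (dil (1 / 2) p)

/-- For a word `𝐢 = (i₁, …, i_m)`, the composition `S_𝐢 = S_{i₁} ∘ ⋯ ∘ S_{i_m}`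
(with `S_∅ = id`). -/
noncomputable def SWord : List (Fin 2 × Fin 2 × Fin 4) → H → H
  | [] => id
  | a :: w => Sim a ∘ SWord w

/-- The image of `(1/2, 1/2, 0)` under a composition of `m` similitudes lies in a dilated lattice,
whose third coordinate is sheared by the first two. -/
theorem exists_int_SWord (w : List (Fin 2 × Fin 2 × Fin 4)) :
    ∃ a b c : ℤ, SWord w ((1:ℝ)/2, (1:ℝ)/2, (0:ℝ)) =
      (((a:ℝ) + 1 / 2) / 2 ^ w.length, ((b:ℝ) + 1 / 2) / 2 ^ w.length,
        ((c:ℝ) / 2 + ((a:ℝ) - b) / 4) / (2 ^ w.length) ^ 2) := by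
  induction w with
  | nil => exact ⟨0, 0, 0, by simp [SWord]⟩
  | cons s w ih =>
    obtain ⟨a, b, c, h⟩ := ih
    obtain ⟨i, j, k⟩ := s
    refine ⟨i.val * 2 ^ w.length + a, j.val * 2 ^ w.length + b,
      2 * k.val * (2 ^ w.length) ^ 2 + c + 2 ^ w.length * (i.val * b - j.val * a), ?_⟩
    have hpos : (2:ℝ) ^ w.length ≠ 0 := by positivity
    simp only [SWord, Function.comp_apply, h, Sim, Hmul, dil, List.length_cons, pow_succ _ w.length]
    push_cast
    generalize (2:ℝ) ^ w.length = t at hpos ⊢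
    refine Prod.ext ?_ (Prod.ext ?_ ?_) <;> simp only <;> field_simp <;> ring

/-- Distinct integers, divided by `t > 0` after a common shift, are at least `1 / t` apart. -/
theorem inv_le_abs_sub_div {a a' : ℤ} (h : a ≠ a') (r : ℝ) {t : ℝ} (ht : 0 < t) :
    1 / t ≤ |((a':ℝ) + r) / t - ((a:ℝ) + r) / t| := by
  rw [← sub_div, abs_div, abs_of_pos ht, add_sub_add_right_eq_sub]
  gcongr
  exact_mod_cast Int.one_le_abs (sub_ne_zero.mpr h.symm)

/-- Two points of the sheared lattice of scale `1 / t` are at box distance at least `1 / (2t)`. -/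
theorem le_dbox_of_ne {a b c a' b' c' : ℤ} {t : ℝ} (ht : 0 < t)
    (hne : (((a:ℝ) + 1 / 2) / t, ((b:ℝ) + 1 / 2) / t, ((c:ℝ) / 2 + ((a:ℝ) - b) / 4) / t ^ 2) ≠
      (((a':ℝ) + 1 / 2) / t, ((b':ℝ) + 1 / 2) / t, ((c':ℝ) / 2 + ((a':ℝ) - b') / 4) / t ^ 2)) :
    1 / 2 / t ≤
      dbox (((a:ℝ) + 1 / 2) / t, ((b:ℝ) + 1 / 2) / t, ((c:ℝ) / 2 + ((a:ℝ) - b) / 4) / t ^ 2)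
        (((a':ℝ) + 1 / 2) / t, ((b':ℝ) + 1 / 2) / t,
          ((c':ℝ) / 2 + ((a':ℝ) - b') / 4) / t ^ 2) := by
  have hhalf : 1 / 2 / t ≤ 1 / t := by gcongr; norm_num
  simp only [dbox, boxNorm, Hmul, Hinv, neg_add_eq_sub]
  by_cases ha : a = a'
  · by_cases hb : b = b'
    · subst ha hb
      have hc : c ≠ c' := by rintro rfl; exact hne rfl
      refine le_max_of_le_right (le_max_of_le_right (Real.le_sqrt_of_sq_le ?_))
      have key := inv_le_abs_sub_div hc (((a:ℝ) - b) / 2) (t := 2 * t ^ 2) (by positivity)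
      calc (1 / 2 / t) ^ 2 ≤ 1 / (2 * t ^ 2) := by
            rw [div_pow, ← div_div]; gcongr; norm_num
        _ ≤ _ := key
        _ = _ := by congr 1; field_simp; ring
    · exact le_max_of_le_right (le_max_of_le_left (hhalf.trans (inv_le_abs_sub_div hb _ ht)))
  · exact le_max_of_le_left (hhalf.trans (inv_le_abs_sub_div ha _ ht))

/-- Lemma 5.2. The level-`n` shortcut centers are `2^{-n+2}`-separated. -/
theorem statement14 (n : ℕ) (hn : 3 ≤ n)
    (w₁ w₂ : List (Fin 2 × Fin 2 × Fin 4))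
    (h₁ : w₁.length = n - 3) (h₂ : w₂.length = n - 3)
    (hne : SWord w₁ ((1:ℝ)/2, (1:ℝ)/2, (0:ℝ)) ≠ SWord w₂ ((1:ℝ)/2, (1:ℝ)/2, (0:ℝ))) :
    (2 : ℝ) ^ ((2 : ℤ) - (n : ℤ)) ≤
      dbox (SWord w₁ ((1:ℝ)/2, (1:ℝ)/2, (0:ℝ))) (SWord w₂ ((1:ℝ)/2, (1:ℝ)/2, (0:ℝ))) := by
  obtain ⟨a, b, c, e₁⟩ := exists_int_SWord w₁
  obtain ⟨a', b', c', e₂⟩ := exists_int_SWord w₂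
  rw [h₁] at e₁
  rw [h₂] at e₂
  rw [e₁, e₂] at hne ⊢
  convert le_dbox_of_ne (by positivity) hne using 1
  obtain ⟨m, rfl⟩ := Nat.exists_eq_add_of_le hn
  rw [Nat.add_sub_cancel_left, ← zpow_natCast, show (2:ℤ) - ((3 + m : ℕ) : ℤ) = -1 - (m : ℤ) by
    push_cast; ring, zpow_sub₀ two_ne_zero]
  norm_num

end Heis
end

section
/- Consider the 16 similitudes of the Heisenberg group S_{i,j,k}(p) = (i/2, j/2, k/4)·δ_{1/2}(p), for i, j ∈ {0,1}, k ∈ {0,1,2,3}, relabeled as S₁, …, S₁₆, and for m ≥ 3 define the level-m shortcut pairs 𝒮_m = { (S_𝐢(1/2,1/2,0), S_𝐢(1/2,1/2,1/64)) : 𝐢 ∈ {1,…,16}^{m−3} }. Then for all n ≥ 3 the set { S_𝐢(1/2,1/2,0) : 𝐢 ∈ {1,…,16}^{n−3} } is disjoint from the union over 3 ≤ m < n and (x, y) ∈ 𝒮_m of the open d_b-neighborhoods of radius 2^{−n+2} of {x, y}. -/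
open scoped ENNReal

namespace Heis

/-- The level-`m` shortcut pairs
`𝒮_m = { (S_𝐢(1/2,1/2,0), S_𝐢(1/2,1/2,1/64)) : 𝐢 ∈ {1,…,16}^{m−3} }`. -/
noncomputable def shortcutPairs (m : ℕ) : Set (H × H) :=
  { xy : H × H | ∃ w : List (Fin 2 × Fin 2 × Fin 4), w.length = m - 3 ∧
      xy = (SWord w ((1:ℝ)/2, (1:ℝ)/2, (0:ℝ)), SWord w ((1:ℝ)/2, (1:ℝ)/2, (1:ℝ)/64)) }

/-- The first coordinate of `S_𝐢(1/2, q)` is an odd multiple of `2^{-(|𝐢|+1)}`. -/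
theorem exists_SWord_half_fst_mul_two_pow (w : List (Fin 2 × Fin 2 × Fin 4)) (q : ℝ × ℝ) :
    ∃ k : ℤ, (SWord w ((1 : ℝ) / 2, q)).1 * 2 ^ (w.length + 1) = 2 * k + 1 := by
  induction w with
  | nil => exact ⟨0, by simp [SWord]⟩
  | cons a w ih =>
    obtain ⟨k, hk⟩ := ih
    refine ⟨((a.1 : ℕ) : ℤ) * 2 ^ w.length + k, ?_⟩
    have h : (SWord (a :: w) ((1 : ℝ) / 2, q)).1 =
        ((a.1 : ℕ) : ℝ) / 2 + 1 / 2 * (SWord w ((1 : ℝ) / 2, q)).1 := rfl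
    rw [h, List.length_cons]
    push_cast
    linear_combination hk

theorem abs_fst_sub_le_dbox (p q : H) : |q.1 - p.1| ≤ dbox p q := by
  rw [sub_eq_neg_add]
  exact le_max_left _ _

/-- Images of points with first coordinate `1/2` under words of different lengths are separated. -/
theorem inv_two_pow_le_dbox_SWord (u w : List (Fin 2 × Fin 2 × Fin 4))
    (h : u.length < w.length) (q r : ℝ × ℝ) :
    ((2 : ℝ) ^ (w.length + 1))⁻¹ ≤
      dbox (SWord u ((1 : ℝ) / 2, q)) (SWord w ((1 : ℝ) / 2, r)) := by
  refine le_trans ?_ (abs_fst_sub_le_dbox _ _)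
  obtain ⟨k, hk⟩ := exists_SWord_half_fst_mul_two_pow u q
  obtain ⟨l, hl⟩ := exists_SWord_half_fst_mul_two_pow w r
  obtain ⟨d, hd⟩ := Nat.exists_eq_add_of_lt h
  set x := (SWord u ((1 : ℝ) / 2, q)).1
  set y := (SWord w ((1 : ℝ) / 2, r)).1
  have key : (y - x) * 2 ^ (w.length + 1) =
      ((2 * (l - (2 * k + 1) * 2 ^ d) + 1 : ℤ) : ℝ) := by
    have hx : x * 2 ^ (w.length + 1) = 2 * 2 ^ d * (2 * k + 1) := by
      rw [← hk, hd]
      ring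
    rw [sub_mul, hl, hx]
    push_cast
    ring
  have hpos : (0 : ℝ) < 2 ^ (w.length + 1) := by positivity
  rw [inv_le_iff_one_le_mul₀ hpos, ← abs_of_pos hpos, ← abs_mul, key]
  exact_mod_cast Int.one_le_abs (by omega)

/-- Lemma 5.1. The level-`n` shortcut centers avoid the open
`2^{-n+2}`-neighborhoods of the endpoints of all lower-level shortcuts. -/
theorem statement15 (n : ℕ) (hn : 3 ≤ n)
    (w : List (Fin 2 × Fin 2 × Fin 4)) (hw : w.length = n - 3)
    (m : ℕ) (hm : 3 ≤ m) (hmn : m < n)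
    (xy : H × H) (hxy : xy ∈ shortcutPairs m) :
    (2 : ℝ) ^ ((2 : ℤ) - (n : ℤ)) ≤ dbox xy.1 (SWord w ((1:ℝ)/2, (1:ℝ)/2, (0:ℝ))) ∧
    (2 : ℝ) ^ ((2 : ℤ) - (n : ℤ)) ≤ dbox xy.2 (SWord w ((1:ℝ)/2, (1:ℝ)/2, (0:ℝ))) := by
  obtain ⟨u, hu, rfl⟩ := hxy
  have hpow : (2 : ℝ) ^ ((2 : ℤ) - (n : ℤ)) = ((2 : ℝ) ^ (w.length + 1))⁻¹ := by
    rw [← zpow_natCast, ← zpow_neg]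
    congr 1
    omega
  have hlt : u.length < w.length := by omega
  rw [hpow]
  exact ⟨inv_two_pow_le_dbox_SWord u w hlt _ _, inv_two_pow_le_dbox_SWord u w hlt _ _⟩

end Heis
end
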